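/- The logic LTL_NT is decidable: there is an algorithm (a computable function from formulas to Booleans) which, given any LTL formula φ, decides whether φ ∈ LTL_NT. -/

import Mathlib

/-- LTL formulas: letters, falsum, implication, Next, Until.
Other Boolean connectives are defined as abbreviations. -/
inductive Fml : Type
  | letter : ℕ → Fml
  | bot : Fml
  | imp : Fml → Fml → Fml
  | next : Fml → Fml
  | untl : Fml → Fml → Fml
deriving DecidableEq

namespace Fml
def neg (φ : Fml) : Fml := imp φ bot
def top : Fml := neg bot
def conj (φ ψ : Fml) : Fml := neg (imp φ (neg ψ))
def disj (φ ψ : Fml) : Fml := imp (neg φ) ψ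
/-- □φ abbreviates ¬(⊤ U ¬φ). -/
def box (φ : Fml) : Fml := neg (untl top (neg φ))
end Fml

/-- Truth in a model on the non-transitive linear frame determined by `t : ℕ → ℕ`:
`φ U ψ` at `a` looks only as far as `t a`. -/
def sat (t : ℕ → ℕ) (V : ℕ → Set ℕ) : Fml → ℕ → Prop
  | .letter p, a => a ∈ V p
  | .bot, _ => False
  | .imp φ ψ, a => sat t V φ a → sat t V ψ a
  | .next φ, a => sat t V φ (a + 1)
  | .untl φ ψ, a => ∃ b, a ≤ b ∧ b ≤ t a ∧ sat t V ψ b ∧ ∀ c, a ≤ c → c < b → sat t V φ c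

/-- A non-transitive linear frame: `t i > i` and `t` is increasing on successive points. -/
def NTFrame (t : ℕ → ℕ) : Prop := (∀ i, i < t i) ∧ (∀ i, t i < t (i + 1))

/-- The logic LTL_NT. -/
def LTLNT : Set Fml := {φ | ∀ t, NTFrame t → ∀ V a, sat t V φ a}

/-- Standard LTL semantics on ⟨ℕ, ≤, Next⟩. -/
def satStd (V : ℕ → Set ℕ) : Fml → ℕ → Prop
  | .letter p, a => a ∈ V p
  | .bot, _ => False
  | .imp φ ψ, a => satStd V φ a → satStd V ψ a
  | .next φ, a => satStd V φ (a + 1)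
  | .untl φ ψ, a => ∃ b, a ≤ b ∧ satStd V ψ b ∧ ∀ c, a ≤ c → c < b → satStd V φ c

/-- The standard linear temporal logic LTL. -/
def LTL : Set Fml := {φ | ∀ V a, satStd V φ a}

/-- The logic LTL_NT(m) of uniform intransitivity `m` (frame with `t i = i + m`). -/
def LTLNTm (m : ℕ) : Set Fml := {φ | ∀ V a, sat (· + m) V φ a}

/-- An inference rule: a finite list of premises and a conclusion. -/
structure Rule where
  prem : List Fml
  concl : Fml

/-- A rule is valid in a model iff truth of all premises at all points implies
truth of the conclusion at all points. -/
def validInModel (t : ℕ → ℕ) (V : ℕ → Set ℕ) (r : Rule) : Prop :=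
  (∀ φ ∈ r.prem, ∀ a, sat t V φ a) → ∀ a, sat t V r.concl a

/-- A rule is valid in a frame iff it is valid in every model on it. -/
def validInFrame (t : ℕ → ℕ) (r : Rule) : Prop := ∀ V, validInModel t V r

/-- Size of a formula. -/
def Fml.size : Fml → ℕ
  | .letter _ => 1
  | .bot => 1
  | .imp φ ψ => φ.size + ψ.size + 1
  | .next φ => φ.size + 1
  | .untl φ ψ => φ.size + ψ.size + 1

/-- Size of a rule. -/
def Rule.size (r : Rule) : ℕ := (r.prem.map Fml.size).sum + r.concl.size

/-- An injective encoding of formulas into ℕ (to speak about computability). -/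
def encF : Fml → ℕ
  | .letter p => Nat.pair 0 p
  | .bot => Nat.pair 1 0
  | .imp φ ψ => Nat.pair 2 (Nat.pair (encF φ) (encF ψ))
  | .next φ => Nat.pair 3 (encF φ)
  | .untl φ ψ => Nat.pair 4 (Nat.pair (encF φ) (encF ψ))

def encL : List Fml → ℕ
  | [] => 0
  | φ :: l => Nat.pair (encF φ) (encL l) + 1

/-- An injective encoding of rules into ℕ. -/
def encRule (r : Rule) : ℕ := Nat.pair (encL r.prem) (encF r.concl)

/-- A literal: `φ` or `¬φ` according to a Boolean flag (`α⁰ = α`, `α¹ = ¬α`). -/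
def lit (b : Bool) (φ : Fml) : Fml := if b then φ else φ.neg

/-- Conjunction of a list of formulas. -/
def bigConj : List Fml → Fml
  | [] => Fml.top
  | φ :: l => (bigConj l).conj φ

/-- Disjunction of a list of formulas. -/
def bigDisj : List Fml → Fml
  | [] => Fml.bot
  | φ :: l => (bigDisj l).disj φ

/-- The premise of a rule in reduced normal form: a disjunction over `j < l` of
conjunctions of literals over `xᵢ`, `N xᵢ` (for `i < n`) and `xᵢ U x_k` (for `i ≠ k`). -/
def rnfPremise (n l : ℕ) (t0 t1 : Fin l → Fin n → Bool)
    (t2 : Fin l → Fin n → Fin n → Bool) : Fml :=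
  bigDisj ((List.finRange l).map fun j =>
    bigConj ((List.finRange n).map (fun i => lit (t0 j i) (.letter i)) ++
      (List.finRange n).map (fun i => lit (t1 j i) (.next (.letter i))) ++
      ((List.finRange n).flatMap fun i =>
        ((List.finRange n).filter (fun k => k ≠ i)).map fun k =>
          lit (t2 j i k) (.untl (.letter i) (.letter k))))) 

/-- `IsRNF n l r`: the rule `r` is in reduced normal form with `n` letters and
`l` disjuncts, i.e. of the shape `ε / x₁`. -/
def IsRNF (n l : ℕ) (r : Rule) : Prop :=
  0 < n ∧ 0 < l ∧ r.concl = .letter 0 ∧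
    ∃ t0 t1 t2, r.prem = [rnfPremise n l t0 t1 t2]

/-- Next relation of the finite frame ℱ(N(r)): it wraps the last point `T` to `g`. -/
def wNext (T g : ℕ) (a : ℕ) : ℕ := if a = T then g else a + 1

/-- Truth in a model on the finite frame `ℱ(N(r))` obtained from the frame of `t`:
the base set is `[0, t^[r+1] 0]`, `T = t^[r+1] 0` is the last point, whose `Next` is
`G = t^[g] 0`; `until` from `a` follows `wNext` for at most `t a - a` steps, so on the
last interval it acts as if the interval following it were `[t^[g] 0, t^[g+1] 0]`. -/
def satFin (t : ℕ → ℕ) (T G : ℕ) (V : ℕ → Set ℕ) : Fml → ℕ → Prop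
  | .letter p, a => a ∈ V p
  | .bot, _ => False
  | .imp φ ψ, a => satFin t T G V φ a → satFin t T G V ψ a
  | .next φ, a => satFin t T G V φ (wNext T G a)
  | .untl φ ψ, a => ∃ k, k ≤ t a - a ∧ satFin t T G V ψ ((wNext T G)^[k] a) ∧
      ∀ j < k, satFin t T G V φ ((wNext T G)^[j] a)

/-- `r` is refuted by `V` in the finite frame `ℱ(N(rr))` (with parameter `g`) built
from the frame of `t`: all premises hold at every point of the frame, while the
conclusion fails at some point. -/
def refutedFin (t : ℕ → ℕ) (rr g : ℕ) (V : ℕ → Set ℕ) (r : Rule) : Prop :=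
  (∀ φ ∈ r.prem, ∀ a ≤ t^[rr + 1] 0, satFin t (t^[rr + 1] 0) (t^[g] 0) V φ a) ∧
    ∃ a ≤ t^[rr + 1] 0, ¬ satFin t (t^[rr + 1] 0) (t^[g] 0) V r.concl a

/-- Temporal degree: maximal nesting depth of `N` and `U`. -/
def tdeg : Fml → ℕ
  | .letter _ => 0
  | .bot => 0
  | .imp φ ψ => max (tdeg φ) (tdeg ψ)
  | .next φ => tdeg φ + 1
  | .untl φ ψ => max (tdeg φ) (tdeg ψ) + 1

/-- `i`-fold application of `N`. -/
def nPow : ℕ → Fml → Fml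
  | 0, φ => φ
  | k + 1, φ => .next (nPow k φ)

/-- Substitution of formulas for letters. -/
def subst (σ : ℕ → Fml) : Fml → Fml
  | .letter p => σ p
  | .bot => .bot
  | .imp φ ψ => .imp (subst σ φ) (subst σ ψ)
  | .next φ => .next (subst σ φ)
  | .untl φ ψ => .untl (subst σ φ) (subst σ ψ)

/-- A rule is admissible in a logic `L` iff every substitution making all premises
theorems of `L` makes the conclusion a theorem of `L`. -/
def Admissible (L : Set Fml) (r : Rule) : Prop :=
  ∀ σ : ℕ → Fml, (∀ φ ∈ r.prem, subst σ φ ∈ L) → subst σ r.concl ∈ L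

namespace NTDec

/-- Bounded until over `[p,q)` relativised to `E`. -/
def Hit (E P Q : ℕ → Prop) (p q : ℕ) : Prop :=
  ∃ b, p ≤ b ∧ b < q ∧ E b ∧ Q b ∧ ∀ c, p ≤ c → c < b → E c → P c

/-- `P` holds on the `E`-points of `[p,q)`. -/
def All (E P : ℕ → Prop) (p q : ℕ) : Prop := ∀ c, p ≤ c → c < q → E c → P c

/-- The full set. -/
def Full : ℕ → Prop := fun _ => True

lemma hit_append {E P Q : ℕ → Prop} {p q s : ℕ} (h1 : p ≤ q) (h2 : q ≤ s) :
    Hit E P Q p s ↔ Hit E P Q p q ∨ (All E P p q ∧ Hit E P Q q s) := by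
  constructor
  · rintro ⟨b, hb1, hb2, hb3, hb4, hb5⟩
    rcases lt_or_ge b q with h | h
    · exact Or.inl ⟨b, hb1, h, hb3, hb4, hb5⟩
    · exact Or.inr ⟨fun c h3 h4 h5 => hb5 c h3 (by omega) h5,
        b, h, hb2, hb3, hb4, fun c h3 h4 h5 => hb5 c (by omega) h4 h5⟩
  · rintro (⟨b, hb1, hb2, hb3, hb4, hb5⟩ | ⟨ha, b, hb1, hb2, hb3, hb4, hb5⟩)
    · exact ⟨b, hb1, by omega, hb3, hb4, hb5⟩
    · refine ⟨b, by omega, hb2, hb3, hb4, fun c h3 h4 h5 => ?_⟩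
      rcases lt_or_ge c q with h | h
      · exact ha c h3 h h5
      · exact hb5 c h h4 h5

lemma all_append {E P : ℕ → Prop} {p q s : ℕ} (h1 : p ≤ q) (h2 : q ≤ s) :
    All E P p s ↔ All E P p q ∧ All E P q s := by
  constructor
  · intro h
    exact ⟨fun c h3 h4 => h c h3 (by omega), fun c h3 h4 => h c (by omega) h4⟩
  · rintro ⟨ha, hb⟩ c h3 h4
    rcases lt_or_ge c q with h | h
    · exact ha c h3 h
    · exact hb c h h4

lemma hit_full {E P Q : ℕ → Prop} {p q : ℕ} (h : ∀ c, p ≤ c → c < q → E c) :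
    Hit E P Q p q ↔ Hit Full P Q p q := by
  constructor
  · rintro ⟨b, h1, h2, h3, h4, h5⟩
    exact ⟨b, h1, h2, trivial, h4, fun c h6 h7 _ => h5 c h6 h7 (h c h6 (by omega))⟩
  · rintro ⟨b, h1, h2, h3, h4, h5⟩
    exact ⟨b, h1, h2, h b h1 h2, h4, fun c h6 h7 _ => h5 c h6 h7 trivial⟩

lemma all_full {E P : ℕ → Prop} {p q : ℕ} (h : ∀ c, p ≤ c → c < q → E c) :
    All E P p q ↔ All Full P p q :=
  ⟨fun h1 c h2 h3 _ => h1 c h2 h3 (h c h2 h3), fun h1 c h2 h3 _ => h1 c h2 h3 trivial⟩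

lemma hit_none {E P Q : ℕ → Prop} {p q : ℕ} (h : ∀ c, p ≤ c → c < q → ¬ E c) :
    ¬ Hit E P Q p q := by
  rintro ⟨b, h1, h2, h3, h4, h5⟩
  exact h b h1 h2 h3

lemma all_none {E P : ℕ → Prop} {p q : ℕ} (h : ∀ c, p ≤ c → c < q → ¬ E c) :
    All E P p q := fun c h1 h2 h3 => absurd h3 (h c h1 h2)

lemma hit_del_right {E P Q : ℕ → Prop} {p x y w s : ℕ} (h1 : p ≤ x) (h2 : x ≤ y) (h3 : y ≤ w)
    (h4 : w ≤ s) (e1 : ∀ c, p ≤ c → c < x → E c) (e2 : ∀ c, x ≤ c → c < y → ¬ E c)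
    (e3 : ∀ c, y ≤ c → c < s → E c) (hh : Hit Full P Q x w ↔ Hit Full P Q y w)
    (ha : All Full P x w ↔ All Full P y w) : Hit E P Q p s ↔ Hit Full P Q p s := by
  rw [hit_append h1 (by omega : x ≤ s), hit_append (by omega : x ≤ w) h4, hit_append h2 h3,
    all_append h2 h3, hit_append (E := Full) h1 (by omega : x ≤ s),
    hit_append (E := Full) (by omega : x ≤ w) h4, hh, ha, hit_full e1, all_full e1,
    hit_full (p := y) (q := w) (fun c a b => e3 c a (by omega)),
    all_full (p := y) (q := w) (fun c a b => e3 c a (by omega)),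
    hit_full (p := w) (q := s) (fun c a b => e3 c (by omega) b)]
  have := hit_none (P := P) (Q := Q) e2
  have := all_none (P := P) e2
  tauto

lemma hit_del_left {E P Q : ℕ → Prop} {p w x y s : ℕ} (h1 : p ≤ w) (h2 : w ≤ x) (h3 : x ≤ y)
    (h4 : y ≤ s) (e1 : ∀ c, p ≤ c → c < x → E c) (e2 : ∀ c, x ≤ c → c < y → ¬ E c)
    (e3 : ∀ c, y ≤ c → c < s → E c) (hh : Hit Full P Q w x ↔ Hit Full P Q w y)
    (ha : All Full P w x ↔ All Full P w y) : Hit E P Q p s ↔ Hit Full P Q p s := by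
  rw [hit_append h1 (by omega : w ≤ s), hit_append (by omega : w ≤ y) h4, hit_append h2 h3,
    all_append h2 h3, hit_append (E := Full) h1 (by omega : w ≤ s),
    hit_append (E := Full) (by omega : w ≤ y) h4, ← hh, ← ha,
    hit_full (p := p) (q := w) (fun c a b => e1 c a (by omega)),
    all_full (p := p) (q := w) (fun c a b => e1 c a (by omega)),
    hit_full (p := w) (q := x) (fun c a b => e1 c (by omega) b),
    all_full (p := w) (q := x) (fun c a b => e1 c (by omega) b),
    hit_full e3]
  have := hit_none (P := P) (Q := Q) e2
  have := all_none (P := P) e2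
  tauto

lemma sat_untl_iff (t : ℕ → ℕ) (V : ℕ → Set ℕ) (φ ψ : Fml) (a : ℕ) :
    sat t V (.untl φ ψ) a ↔ Hit Full (sat t V φ) (sat t V ψ) a (t a + 1) := by
  simp only [sat, Hit, Full]
  constructor
  · rintro ⟨b, h1, h2, h3, h4⟩
    exact ⟨b, h1, by omega, trivial, h3, fun c h5 h6 _ => h4 c h5 h6⟩
  · rintro ⟨b, h1, h2, _, h3, h4⟩
    exact ⟨b, h1, by omega, h3, fun c h5 h6 => h4 c h5 h6 trivial⟩

/-- The submodel on an infinite `t`-closed set. -/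
lemma submodel (t : ℕ → ℕ) (ht : NTFrame t) (V : ℕ → Set ℕ) (E : ℕ → Prop) [DecidablePred E]
    (hinf : (Set.ofPred E).Infinite) (hcl : ∀ a, E a → E (t a)) (n : ℕ)
    (Hn : ∀ ψ, encF ψ ≤ n → ∀ a x, E a → E x → a < x → (∀ y, a < y → y < x → ¬ E y) →
      (sat t V ψ x ↔ sat t V ψ (a + 1)))
    (Hu : ∀ φ ψ, encF φ ≤ n → encF ψ ≤ n → ∀ a, E a →
      (Hit E (sat t V φ) (sat t V ψ) a (t a + 1) ↔
        Hit Full (sat t V φ) (sat t V ψ) a (t a + 1))) :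
    NTFrame (fun a => Nat.count E (t (Nat.nth E a))) ∧
    ∀ ψ, encF ψ ≤ n → ∀ a, sat (fun a => Nat.count E (t (Nat.nth E a)))
      (fun q => {a | Nat.nth E a ∈ V q}) ψ a ↔ sat t V ψ (Nat.nth E a) := by
  have hE : ∀ a, E (Nat.nth E a) := Nat.nth_mem_of_infinite hinf
  have hm : StrictMono (Nat.nth E) := Nat.nth_strictMono hinf
  have hc : ∀ a, Nat.nth E (Nat.count E (t (Nat.nth E a))) = t (Nat.nth E a) :=
    fun a => Nat.nth_count (hcl _ (hE a))
  have htm : StrictMono t := strictMono_nat_of_lt_succ ht.2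
  refine ⟨⟨fun i => ?_, fun i => ?_⟩, ?_⟩
  · rw [← hm.lt_iff_lt, hc]; exact ht.1 _
  · rw [← hm.lt_iff_lt, hc, hc]; exact htm (hm (Nat.lt_succ_self i))
  intro ψ
  induction ψ with
  | letter p => intro _ a; simp [sat]
  | bot => intro _ a; simp [sat]
  | imp φ ψ ih1 ih2 =>
    intro h a
    simp only [encF] at h
    have h3 := Nat.right_le_pair 2 (Nat.pair (encF φ) (encF ψ))
    have h1 := Nat.left_le_pair (encF φ) (encF ψ)
    have h2 := Nat.right_le_pair (encF φ) (encF ψ)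
    simp only [sat, ih1 (by omega) a, ih2 (by omega) a]
  | next φ ih =>
    intro h a
    simp only [encF] at h
    have h3 := Nat.right_le_pair 3 (encF φ)
    simp only [sat]
    rw [ih (by omega)]
    refine Hn φ (by omega) _ _ (hE a) (hE _) (hm (Nat.lt_succ_self a)) ?_
    intro y h1 h2 h4
    have := Nat.le_nth_of_lt_nth_succ h2 h4
    omega
  | untl φ ψ ih1 ih2 =>
    intro h a
    simp only [encF] at h
    have h3 := Nat.right_le_pair 4 (Nat.pair (encF φ) (encF ψ))
    have h1 := Nat.left_le_pair (encF φ) (encF ψ)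
    have h2 := Nat.right_le_pair (encF φ) (encF ψ)
    rw [sat_untl_iff t V, ← Hu φ ψ (by omega) (by omega) _ (hE a)]
    simp only [sat, ih1 (by omega), ih2 (by omega)]
    constructor
    · rintro ⟨b, hb1, hb2, hb3, hb4⟩
      refine ⟨Nat.nth E b, hm.monotone hb1, ?_, hE b, hb3, ?_⟩
      · have := hm.monotone hb2
        rw [hc] at this; omega
      · intro c hc1 hc2 hc3
        rw [← Nat.nth_count hc3] at hc1 hc2 ⊢
        exact hb4 _ (hm.le_iff_le.1 hc1) (hm.lt_iff_lt.1 hc2)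
    · rintro ⟨b, hb1, hb2, hb3, hb4, hb5⟩
      rw [← Nat.nth_count hb3] at hb1 hb2 hb4 hb5
      refine ⟨Nat.count E b, hm.le_iff_le.1 hb1, ?_, hb4, fun c hc1 hc2 => ?_⟩
      · rw [← hm.le_iff_le, hc]; omega
      · exact hb5 _ (hm.monotone hc1) (hm hc2) (hE c)

/-- The least point whose `j`-th `t`-iterate reaches `z`. -/
noncomputable def cut (t : ℕ → ℕ) (j z : ℕ) : ℕ := sInf {x | z ≤ t^[j] x}

lemma iter_sm {t : ℕ → ℕ} (ht : NTFrame t) (j : ℕ) : StrictMono (t^[j]) :=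
  (strictMono_nat_of_lt_succ ht.2).iterate j

lemma cut_le_iff {t : ℕ → ℕ} (ht : NTFrame t) (j z x : ℕ) : cut t j z ≤ x ↔ z ≤ t^[j] x := by
  have hne : {x | z ≤ t^[j] x}.Nonempty := ⟨z, (iter_sm ht j).id_le z⟩
  constructor
  · intro h
    have h1 : z ≤ t^[j] (cut t j z) := Nat.sInf_mem hne
    exact h1.trans ((iter_sm ht j).monotone h)
  · intro h
    exact Nat.sInf_le h

lemma lt_cut_iff {t : ℕ → ℕ} (ht : NTFrame t) (j z x : ℕ) : x < cut t j z ↔ t^[j] x < z := by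
  have := cut_le_iff ht j z x
  omega

lemma r_sm {t : ℕ → ℕ} (ht : NTFrame t) : StrictMono (fun i => t^[i] 0) := by
  apply strictMono_nat_of_lt_succ
  intro i
  simp only [Function.iterate_succ_apply']
  exact ht.1 _

lemma exists_row {t : ℕ → ℕ} (K a : ℕ) (h : a < t^[K+1] 0) :
    ∃ i j, i + j = K ∧ t^[i] 0 ≤ a ∧ a < t^[i+1] 0 := by
  induction K with
  | zero => exact ⟨0, 0, rfl, Nat.zero_le _, h⟩
  | succ K ih =>
    rcases lt_or_ge a (t^[K+1] 0) with h1 | h1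
    · obtain ⟨i, j, h2, h3⟩ := ih h1
      exact ⟨i, j+1, by omega, h3⟩
    · exact ⟨K+1, 0, rfl, h1, h⟩

lemma shrink (t : ℕ → ℕ) (ht : NTFrame t) (V : ℕ → Set ℕ) (n K z z' : ℕ)
    (hz : t^[K] 0 < z) (hzz : z < z') (hz' : z' ≤ t^[K+1] 0)
    (hs : ∀ i j, i + j = K → ∀ φ ψ, encF φ ≤ n → encF ψ ≤ n →
      (sat t V ψ (cut t j z) ↔ sat t V ψ (cut t j z')) ∧
      (Hit Full (sat t V φ) (sat t V ψ) (cut t j z) (t^[i+1] 0) ↔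
        Hit Full (sat t V φ) (sat t V ψ) (cut t j z') (t^[i+1] 0)) ∧
      (All Full (sat t V φ) (cut t j z) (t^[i+1] 0) ↔
        All Full (sat t V φ) (cut t j z') (t^[i+1] 0)) ∧
      (Hit Full (sat t V φ) (sat t V ψ) (t^[i] 0) (cut t j z) ↔
        Hit Full (sat t V φ) (sat t V ψ) (t^[i] 0) (cut t j z')) ∧
      (All Full (sat t V φ) (t^[i] 0) (cut t j z) ↔
        All Full (sat t V φ) (t^[i] 0) (cut t j z'))) :
    ∃ t' V', NTFrame t' ∧ t'^[K+1] 0 < t^[K+1] 0 ∧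
      ∀ ψ, encF ψ ≤ n → (sat t' V' ψ 0 ↔ sat t V ψ 0) := by
  classical
  have rsm : ∀ {i j}, t^[i] 0 < t^[j] 0 ↔ i < j := fun {i j} => (r_sm ht).lt_iff_lt
  have itm := fun j => iter_sm ht j
  set E : ℕ → Prop := fun x => ∀ j, t^[j] x < z ∨ z' ≤ t^[j] x with hEdef
  -- rows
  have rowE : ∀ i j, i + j = K → ∀ x, t^[i] 0 ≤ x → x < t^[i+1] 0 →
      (E x ↔ x < cut t j z ∨ cut t j z' ≤ x) := by
    intro i j hij x h1 h2
    rw [lt_cut_iff ht, cut_le_iff ht]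
    refine ⟨fun h => h j, fun h j' => ?_⟩
    by_contra hcon
    push Not at hcon
    have a1 := (itm j').monotone h1
    have a2 := itm j' h2
    rw [← Function.iterate_add_apply] at a1 a2
    have b1 : j' + i < K + 1 := rsm.1 (by omega)
    have b2 : K < j' + (i + 1) := rsm.1 (by omega)
    have : j' = j := by omega
    subst this
    omega
  have bigE : ∀ x, t^[K+1] 0 ≤ x → E x := by
    intro x h j
    right
    exact hz'.trans (h.trans ((itm j).id_le x))
  have cb : ∀ i j, i + j = K → ∀ y, t^[K] 0 < y → y ≤ t^[K+1] 0 →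
      t^[i] 0 < cut t j y ∧ cut t j y ≤ t^[i+1] 0 := by
    intro i j hij y h1 h2
    rw [lt_cut_iff ht, cut_le_iff ht, ← Function.iterate_add_apply, ← Function.iterate_add_apply]
    rw [show j + i = K by omega, show j + (i+1) = K+1 by omega]
    exact ⟨h1, h2⟩
  have ccle : ∀ j, cut t j z ≤ cut t j z' := by
    intro j
    rw [cut_le_iff ht]
    exact hzz.le.trans ((cut_le_iff ht j z' _).1 le_rfl)
  have hrE : ∀ i, E (t^[i] 0) := by
    intro i j
    rw [← Function.iterate_add_apply]
    rcases Nat.lt_or_ge (j + i) (K+1) with h | h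
    · left
      exact lt_of_le_of_lt ((r_sm ht).monotone (by omega : j + i ≤ K)) hz
    · right
      exact hz'.trans ((r_sm ht).monotone h)
  have hinf : (Set.ofPred E).Infinite := by
    apply (Set.infinite_of_injective_forall_mem (f := fun i => t^[i] 0) (r_sm ht).injective)
    exact hrE
  have hcl : ∀ a, E a → E (t a) := by
    intro a h j
    rw [← Function.iterate_succ_apply]
    exact h (j+1)
  have main := submodel t ht V E hinf hcl n ?_ ?_
  · refine ⟨_, fun q => {a | Nat.nth E a ∈ V q}, main.1, ?_, fun ψ hψ => ?_⟩
    · have key : ∀ i, (fun a => Nat.count E (t (Nat.nth E a)))^[i] 0 = Nat.count E (t^[i] 0) := by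
        intro i
        induction i with
        | zero => simp
        | succ i ih =>
          rw [Function.iterate_succ_apply', ih]
          rw [Nat.nth_count (hrE i), ← Function.iterate_succ_apply' t]
      rw [key]
      have hnz : ¬ E z := by
        intro h
        have := h 0
        simp at this
        omega
      rw [Nat.count_eq_card_filter_range]
      have : (Finset.filter E (Finset.range (t^[K+1] 0))) ⊂ Finset.range (t^[K+1] 0) := by
        rw [Finset.filter_ssubset]
        exact ⟨z, by simp only [Finset.mem_range]; omega, hnz⟩
      simpa using Finset.card_lt_card this
    · rw [main.2 ψ hψ 0, Nat.nth_zero_of_zero (hrE 0)]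
  · -- next
    intro ψ hψ a x ha hx hax hno
    by_cases h1 : E (a+1)
    · have : x = a + 1 := by
        by_contra hne
        exact hno (a+1) (by omega) (by omega) h1
      rw [this]
    have h2 : a + 1 < t^[K+1] 0 := by
      by_contra h
      exact h1 (bigE _ (by omega))
    obtain ⟨i, j, hij, h3, h4⟩ := exists_row K (a+1) h2
    have hr := rowE i j hij
    obtain ⟨c1, c2⟩ := cb i j hij z hz (by omega)
    obtain ⟨c3, c4⟩ := cb i j hij z' (by omega) hz'
    have h5 := (hr (a+1) h3 h4).not.1 h1
    have h3' : t^[i] 0 ≤ a := by omega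
    have h6 := (hr a h3' (by omega)).1 ha
    have e1 : a + 1 = cut t j z := by omega
    have hE' : E (cut t j z') := by
      rcases c4.lt_or_eq with h | h
      · exact (hr _ c3.le h).2 (Or.inr le_rfl)
      · rw [h]; exact hrE _
    have e2 : x = cut t j z' := by
      rcases lt_trichotomy x (cut t j z') with h | h | h
      · have := (hr x (by omega) (by omega)).1 hx
        omega
      · exact h
      · exact absurd hE' (hno _ (by omega) h)
    rw [e1, e2]
    exact (hs i j hij ψ ψ hψ hψ).1.symm
  · -- until
    intro φ ψ hφ hψ a ha
    rcases Nat.lt_or_ge a (t^[K+1] 0) with hlt | hge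
    swap
    · exact hit_full fun c h1 _ => bigE c (by omega)
    obtain ⟨i, j, hij, h3, h4⟩ := exists_row K a hlt
    have hr := rowE i j hij
    obtain ⟨c1, c2⟩ := cb i j hij z hz (by omega)
    obtain ⟨c3, c4⟩ := cb i j hij z' (by omega) hz'
    have cc := ccle j
    have hta1 : t^[i+1] 0 ≤ t a := by
      have := (itm 1).monotone h3
      rwa [← Function.iterate_add_apply, Nat.add_comm] at this
    have hta2 : t a < t^[i+2] 0 := by
      have := (itm 1) h4
      rwa [← Function.iterate_add_apply, show 1 + (i+1) = i+2 by omega] at this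
    obtain ⟨s1, s2, s3, s4, s5⟩ := hs i j hij φ ψ hφ hψ
    rcases (hr a h3 h4).1 ha with hl | hl
    · refine hit_del_right (x := cut t j z) (y := cut t j z') (w := t^[i+1] 0)
        hl.le cc c4 (by omega) ?_ ?_ ?_ s2 s3
      · intro c d1 d2
        exact (hr c (by omega) (by omega)).2 (Or.inl d2)
      · intro c d1 d2
        rw [hr c (by omega) (by omega)]
        omega
      · intro c d1 d2
        rcases Nat.lt_or_ge c (t^[i+1] 0) with h | h
        · exact (hr c (by omega) h).2 (Or.inr d1)
        rcases j with _ | j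
        · apply bigE
          rw [← hij]; exact h
        · refine (rowE (i+1) j (by omega) c h (show c < t^[i+2] 0 by omega)).2 (Or.inl ?_)
          rw [lt_cut_iff ht]
          rw [lt_cut_iff ht, Function.iterate_succ_apply] at hl
          exact lt_of_le_of_lt ((itm j).monotone (by omega)) hl
    · rcases j with _ | j
      · apply hit_full
        intro c d1 d2
        rcases Nat.lt_or_ge c (t^[i+1] 0) with h | h
        · exact (hr c (by omega) h).2 (Or.inr (by omega))
        · apply bigE
          rw [← hij]; exact h
      · have hr' := rowE (i+1) j (by omega)
        obtain ⟨c1', c2'⟩ := cb (i+1) j (by omega) z hz (by omega)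
        obtain ⟨c3', c4'⟩ := cb (i+1) j (by omega) z' (by omega) hz'
        have cc' := ccle j
        obtain ⟨-, -, -, s4', s5'⟩ := hs (i+1) j (by omega) φ ψ hφ hψ
        have hta3 : cut t j z' ≤ t a := by
          rw [cut_le_iff ht] at hl ⊢
          rwa [Function.iterate_succ_apply] at hl
        refine hit_del_left (x := cut t j z) (y := cut t j z') (w := t^[i+1] 0)
          h4.le c1'.le cc' (by omega) ?_ ?_ ?_ s4' s5'
        · intro c d1 d2
          rcases Nat.lt_or_ge c (t^[i+1] 0) with h | h
          · exact (hr c (by omega) h).2 (Or.inr (by omega))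
          · exact (hr' c h (by omega)).2 (Or.inl d2)
        · intro c d1 d2
          rw [hr' c (by omega) (by omega)]
          omega
        · intro c d1 d2
          exact (hr' c (by omega) (show c < t^[i+2] 0 by omega)).2 (Or.inr d1)

/-- Total decoding of natural numbers into formulas. -/
def dec (e : ℕ) : Fml :=
  if _h0 : (Nat.unpair e).1 = 0 then .letter (Nat.unpair e).2
  else if (Nat.unpair e).1 = 2 then
    .imp (dec (Nat.unpair (Nat.unpair e).2).1) (dec (Nat.unpair (Nat.unpair e).2).2)
  else if (Nat.unpair e).1 = 3 then .next (dec (Nat.unpair e).2)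
  else if (Nat.unpair e).1 = 4 then
    .untl (dec (Nat.unpair (Nat.unpair e).2).1) (dec (Nat.unpair (Nat.unpair e).2).2)
  else .bot
termination_by e
decreasing_by
  all_goals
    have h1 := Nat.unpair_add_le e
    have h2 := Nat.unpair_left_le (Nat.unpair e).2
    have h3 := Nat.unpair_right_le (Nat.unpair e).2
    omega

lemma dec_encF (φ : Fml) : dec (encF φ) = φ := by
  induction φ with
  | letter p => rw [dec]; simp [encF]
  | bot => rw [dec]; simp [encF]
  | imp φ ψ h1 h2 => rw [dec]; simp [encF, h1, h2]
  | next φ h1 => rw [dec]; simp [encF, h1]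
  | untl φ ψ h1 h2 => rw [dec]; simp [encF, h1, h2]

/-- Bound on the number of states. -/
def stB (n : ℕ) : ℕ := 2 ^ ((n+1) * ((n+1) * ((n+1) * 5)))

/-- Bound on the model size. -/
def NB (n : ℕ) : ℕ := (n+1) * stB n

lemma r_gap {t : ℕ → ℕ} (ht : NTFrame t) (i m : ℕ) (h : i ≤ m) :
    t^[i+1] 0 + t^[m] 0 ≤ t^[m+1] 0 + t^[i] 0 := by
  have hstep : ∀ a d, t a + d ≤ t (a + d) := by
    intro a d
    induction d with
    | zero => simp
    | succ d ih =>
      have := ht.2 (a + d)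
      rw [← Nat.add_assoc a d 1]
      omega
  induction m, h using Nat.le_induction with
  | base => omega
  | succ m hm ih =>
    have h1 : t^[m] 0 < t^[m+1] 0 := r_sm ht (Nat.lt_succ_self m)
    have h2 := hstep (t^[m] 0) (t^[m+1] 0 - t^[m] 0)
    rw [show t^[m] 0 + (t^[m+1] 0 - t^[m] 0) = t^[m+1] 0 by omega] at h2
    rw [← Function.iterate_succ_apply' t, ← Function.iterate_succ_apply' t] at h2
    simp only [Nat.succ_eq_add_one] at h2
    omega

lemma r_bound {t : ℕ → ℕ} (ht : NTFrame t) (K : ℕ) :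
    t^[K+1] 0 ≤ (K+1) * (t^[K+1] 0 - t^[K] 0) := by
  have : ∀ m, m ≤ K + 1 → t^[m] 0 ≤ m * (t^[K+1] 0 - t^[K] 0) := by
    intro m
    induction m with
    | zero => intro _; simp
    | succ m ih =>
      intro hm
      have h1 := ih (by omega)
      have h2 := r_gap ht m K (by omega)
      have h3 : t^[K] 0 < t^[K+1] 0 := r_sm ht (Nat.lt_succ_self K)
      rw [Nat.succ_mul]
      omega
  exact this _ le_rfl

open Classical in
/-- The state attached to a cut. -/
noncomputable def state (t : ℕ → ℕ) (V : ℕ → Set ℕ) (n z : ℕ) :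
    Fin (n+1) × Fin (n+1) × Fin (n+1) × Fin 5 → Bool := fun x =>
  let P := sat t V (dec x.2.1)
  let Q := sat t V (dec x.2.2.1)
  let j := n - x.1.1
  let i := x.1.1
  match x.2.2.2 with
  | 0 => decide (Q (cut t j z))
  | 1 => decide (Hit Full P Q (cut t j z) (t^[i+1] 0))
  | 2 => decide (All Full P (cut t j z) (t^[i+1] 0))
  | 3 => decide (Hit Full P Q (t^[i] 0) (cut t j z))
  | 4 => decide (All Full P (t^[i] 0) (cut t j z))

lemma small_model (φ : Fml) (N : ℕ) : ∀ (t : ℕ → ℕ) (V : ℕ → Set ℕ), NTFrame t →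
    ¬ sat t V φ 0 → t^[encF φ + 1] 0 = N →
    ∃ t' V', NTFrame t' ∧ ¬ sat t' V' φ 0 ∧ t'^[encF φ + 1] 0 ≤ NB (encF φ) := by
  induction N using Nat.strong_induction_on with
  | _ N ih =>
  intro t V ht hs hN
  by_cases hle : t^[encF φ + 1] 0 ≤ NB (encF φ)
  · exact ⟨t, V, ht, hs, hle⟩
  set n := encF φ with hn
  have hb := r_bound ht n
  have hL : stB n < t^[n+1] 0 - t^[n] 0 := by
    by_contra hcon
    apply hle
    refine hb.trans ?_
    exact Nat.mul_le_mul_left _ (by omega)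
  have hpig : ∃ z ∈ Finset.Ioc (t^[n] 0) (t^[n+1] 0), ∃ z' ∈ Finset.Ioc (t^[n] 0) (t^[n+1] 0),
      z ≠ z' ∧ state t V n z = state t V n z' := by
    apply Finset.exists_ne_map_eq_of_card_lt_of_maps_to (t := Finset.univ)
    · rw [Nat.card_Ioc]
      simpa [stB] using hL
    · intro x _; simp
  have hpig2 : ∃ z z', t^[n] 0 < z ∧ z < z' ∧ z' ≤ t^[n+1] 0 ∧
      state t V n z = state t V n z' := by
    obtain ⟨z, h1, z', h2, h3, h4⟩ := hpig
    rw [Finset.mem_Ioc] at h1 h2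
    rcases lt_or_gt_of_ne h3 with h | h
    · exact ⟨z, z', h1.1, h, h2.2, h4⟩
    · exact ⟨z', z, h2.1, h, h1.2, h4.symm⟩
  obtain ⟨z, z', h1, h2, h3, h4⟩ := hpig2
  obtain ⟨t', V', g1, g2, g3⟩ := shrink t ht V n n z z' h1 h2 h3 (by
    intro i j hij φ ψ hφ hψ
    have key := fun k : Fin 5 => congrFun h4
      (⟨i, by omega⟩, ⟨encF φ, by omega⟩, ⟨encF ψ, by omega⟩, k)
    have hj : n - i = j := by omega
    have k0 := key 0
    have k1 := key 1
    have k2 := key 2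
    have k3 := key 3
    have k4 := key 4
    simp only [state, dec_encF, hj, decide_eq_decide] at k0 k1 k2 k3 k4
    exact ⟨k0, k1, k2, k3, k4⟩)
  exact ih _ (by omega) t' V' g1 (by rwa [g3 φ le_rfl]) rfl

lemma sat_shift (t : ℕ → ℕ) (ht : NTFrame t) (V : ℕ → Set ℕ) (a : ℕ) (φ : Fml) : ∀ b,
    sat (fun i => t (i + a) - a) (fun q => {i | i + a ∈ V q}) φ b ↔ sat t V φ (b + a) := by
  induction φ with
  | letter p => intro b; simp [sat]
  | bot => intro b; simp [sat]
  | imp φ ψ h1 h2 => intro b; simp only [sat, h1, h2]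
  | next φ h => intro b; simp only [sat, h]; rw [Nat.add_right_comm]
  | untl φ ψ h1 h2 =>
    intro b
    simp only [sat, h1, h2]
    constructor
    · rintro ⟨x, hx1, hx2, hx3, hx4⟩
      have := ht.1 (b + a)
      refine ⟨x + a, by omega, by omega, hx3, fun c hc1 hc2 => ?_⟩
      have := hx4 (c - a) (by omega) (by omega)
      rwa [show c - a + a = c by omega] at this
    · rintro ⟨x, hx1, hx2, hx3, hx4⟩
      refine ⟨x - a, by omega, by omega, ?_, fun c hc1 hc2 => hx4 _ (by omega) (by omega)⟩
      rwa [show x - a + a = x by omega]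

lemma not_mem_iff (φ : Fml) : φ ∉ LTLNT ↔ ∃ t V, NTFrame t ∧ ¬ sat t V φ 0 ∧
    t^[encF φ + 1] 0 ≤ NB (encF φ) := by
  constructor
  · intro h
    simp only [LTLNT, Set.mem_ofPred_eq] at h
    push Not at h
    obtain ⟨t, ht, V, a, ha⟩ := h
    refine small_model φ _ (fun i => t (i + a) - a) (fun q => {i | i + a ∈ V q}) ?_ ?_ rfl
    · constructor
      · intro i
        have := ht.1 (i + a)
        show i < t (i + a) - a
        omega
      · intro i
        have h1 := ht.2 (i + a)
        have h2 := ht.1 (i + a)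
        show t (i + a) - a < t (i + 1 + a) - a
        rw [Nat.add_right_comm]
        omega
    · rw [sat_shift t ht]
      simpa using ha
  · rintro ⟨t, V, h1, h2, _⟩ h
    exact h2 (h t h1 V 0)

/-- The `i`-th digit of `m` in base `K`. -/
def dig (K m i : ℕ) : ℕ := m / K ^ i % K

lemma exists_dig (K : ℕ) (M : ℕ) : ∀ f : ℕ → ℕ, (∀ i, f i < K) →
    ∃ m, m < K ^ M ∧ ∀ i < M, dig K m i = f i := by
  induction M with
  | zero => intro f _; exact ⟨0, by simp, by intro i hi; omega⟩
  | succ M ih =>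
    intro f hf
    obtain ⟨m, h1, h2⟩ := ih (fun i => f (i+1)) (fun i => hf _)
    have hK : 0 < K := lt_of_le_of_lt (Nat.zero_le _) (hf 0)
    refine ⟨f 0 + K * m, ?_, ?_⟩
    · have h3 : K * (m + 1) ≤ K * K ^ M := Nat.mul_le_mul_left _ h1
      have := hf 0
      rw [pow_succ, Nat.mul_comm (K ^ M) K]
      rw [Nat.mul_add] at h3
      omega
    · intro i hi
      rcases i with _ | i
      · simp [dig, Nat.mod_eq_of_lt (hf 0)]
      · rw [← h2 i (by omega)]
        unfold dig
        rw [pow_succ, Nat.mul_comm (K ^ i) K, ← Nat.div_div_eq_div_mul,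
          Nat.add_mul_div_left _ _ hK, Nat.div_eq_of_lt (hf 0), Nat.zero_add]

/-- The frame function coded by `m`. -/
def tm (N m a : ℕ) : ℕ :=
  if a ≤ N ∧ dig (N+2) m a ≤ N then dig (N+2) m a else a + N + 1

/-- The labelling coded by `m`. -/
def Sm (N m e a : ℕ) : Prop := dig 2 m (e * (N+1) + a) = 1

/-- Local correctness of the labelling for code `e` at point `a`. -/
def Loc (N m k e a : ℕ) : Prop :=
  (¬ (Nat.unpair e).1 = 1 ∨ ¬ Sm N k e a) ∧
  (¬ (Nat.unpair e).1 = 2 ∨ (Sm N k e a ↔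
    (¬ Sm N k (Nat.unpair (Nat.unpair e).2).1 a ∨ Sm N k (Nat.unpair (Nat.unpair e).2).2 a))) ∧
  (¬ (Nat.unpair e).1 = 3 ∨ ¬ a < N ∨ (Sm N k e a ↔ Sm N k (Nat.unpair e).2 (a+1))) ∧
  (¬ (Nat.unpair e).1 = 4 ∨ ¬ tm N m a ≤ N ∨ (Sm N k e a ↔
    ∃ b < N + 1, (a ≤ b ∧ b ≤ tm N m a ∧ Sm N k (Nat.unpair (Nat.unpair e).2).2 b ∧
      ∀ c < b, (c < a ∨ Sm N k (Nat.unpair (Nat.unpair e).2).1 c))))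

/-- Correctness of a certificate. -/
def Check (n N m k : ℕ) : Prop :=
  (∀ a < N + 1, a < tm N m a) ∧ (∀ a < N + 1, tm N m a < tm N m (a+1)) ∧
  (tm N m)^[n+1] 0 ≤ N ∧ ¬ Sm N k n 0 ∧ ∀ e < n + 1, ∀ a < N + 1, Loc N m k e a

lemma tm_frame {n N m k : ℕ} (h : Check n N m k) : NTFrame (tm N m) := by
  constructor
  · intro i
    rcases Nat.lt_or_ge i (N+1) with h1 | h1
    · exact h.1 i h1
    · unfold tm
      rw [if_neg (by omega)]; omega
  · intro i
    rcases Nat.lt_or_ge i (N+1) with h1 | h1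
    · exact h.2.1 i h1
    · unfold tm
      rw [if_neg (by omega), if_neg (by omega)]; omega

lemma check_sat {n N m k : ℕ} (h : Check n N m k) (φ : Fml) : encF φ ≤ n → ∀ a,
    a ≤ (tm N m)^[n - encF φ + 1] 0 →
    (sat (tm N m) (fun p => {a | Sm N k (Nat.pair 0 p) a}) φ a ↔ Sm N k (encF φ) a) := by
  have hf := tm_frame h
  have hb : ∀ i, i ≤ n + 1 → ∀ a, a ≤ (tm N m)^[i] 0 → a ≤ N := by
    intro i hi a ha
    exact ha.trans (((r_sm hf).monotone hi).trans h.2.2.1)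
  have hmono : ∀ i j, i ≤ j → ∀ a, a ≤ (tm N m)^[i] 0 → a ≤ (tm N m)^[j] 0 := by
    intro i j hij a ha
    exact ha.trans ((r_sm hf).monotone hij)
  have hloc := h.2.2.2.2
  induction φ with
  | letter p => intro _ a _; simp [sat, encF]
  | bot =>
    intro hn a ha
    have := (hloc (encF .bot) (by omega) a (by have := hb _ (by omega) a ha; omega)).1
    simp only [encF, Nat.unpair_pair] at this
    simp only [sat, encF]
    simpa using this
  | imp φ ψ ih1 ih2 =>
    intro hn a ha
    have l := (hloc (encF (.imp φ ψ)) (by omega) a (by have := hb _ (by omega) a ha; omega)).2.1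
    simp only [encF] at hn ha
    have h3 := Nat.add_le_pair 2 (Nat.pair (encF φ) (encF ψ))
    have h1 := Nat.left_le_pair (encF φ) (encF ψ)
    have h2 := Nat.right_le_pair (encF φ) (encF ψ)
    simp only [sat]
    rw [ih1 (by omega) a (hmono _ _ (by omega) a ha), ih2 (by omega) a (hmono _ _ (by omega) a ha)]
    simp only [encF, Nat.unpair_pair] at l ⊢
    tauto
  | next φ ih =>
    intro hn a ha
    have l := (hloc (encF (.next φ)) (by omega) a
      (by have := hb _ (by omega) a ha; omega)).2.2.1
    simp only [encF] at hn ha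
    have h3 := Nat.add_le_pair 3 (encF φ)
    have ha1 : a + 1 ≤ (tm N m)^[n - encF φ + 1] 0 := by
      refine hmono (n - Nat.pair 3 (encF φ) + 1 + 1) _ (by omega) _ ?_
      have := (r_sm hf) (Nat.lt_succ_self (n - Nat.pair 3 (encF φ) + 1))
      simp only [Nat.succ_eq_add_one] at this
      omega
    have haN := hb _ (by omega) _ ha1
    simp only [sat]
    rw [ih (by omega) _ ha1]
    simp only [encF, Nat.unpair_pair] at l ⊢
    have : a < N := by omega
    tauto
  | untl φ ψ ih1 ih2 =>
    intro hn a ha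
    have l := (hloc (encF (.untl φ ψ)) (by omega) a
      (by have := hb _ (by omega) a ha; omega)).2.2.2
    simp only [encF] at hn ha
    have h3 := Nat.add_le_pair 4 (Nat.pair (encF φ) (encF ψ))
    have h1 := Nat.left_le_pair (encF φ) (encF ψ)
    have h2 := Nat.right_le_pair (encF φ) (encF ψ)
    have hta : tm N m a ≤ (tm N m)^[n - Nat.pair 4 (Nat.pair (encF φ) (encF ψ)) + 1 + 1] 0 := by
      rw [Function.iterate_succ_apply']
      exact (strictMono_nat_of_lt_succ hf.2).monotone ha
    have htN := hb _ (by omega) _ hta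
    have l2 := (l.resolve_left (by simp [encF])).resolve_left (by omega)
    simp only [encF, Nat.unpair_pair] at l2 ⊢
    rw [l2]
    simp only [sat]
    constructor
    · rintro ⟨b, b1, b2, b3, b4⟩
      refine ⟨b, by omega, b1, b2, (ih2 (by omega) b ?_).1 b3, ?_⟩
      · exact hmono _ _ (by omega) _ (b2.trans hta)
      · intro c hc
        rcases Nat.lt_or_ge c a with h5 | h5
        · exact Or.inl h5
        · refine Or.inr ((ih1 (by omega) c ?_).1 (b4 c h5 hc))
          exact hmono _ _ (by omega) _ ((hc.le.trans b2).trans hta)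
    · rintro ⟨b, b0, b1, b2, b3, b4⟩
      refine ⟨b, b1, b2, (ih2 (by omega) b ?_).2 b3, ?_⟩
      · exact hmono _ _ (by omega) _ (b2.trans hta)
      · intro c h5 hc
        refine (ih1 (by omega) c ?_).2 ((b4 c hc).resolve_left (by omega))
        exact hmono _ _ (by omega) _ ((hc.le.trans b2).trans hta)

lemma check_of_model (t : ℕ → ℕ) (ht : NTFrame t) (V : ℕ → Set ℕ) (n N : ℕ)
    (hN : t^[n+1] 0 ≤ N) (hs : ¬ sat t V (dec n) 0) :
    ∃ m < (N+2)^(N+1), ∃ k < 2^((n+1)*(N+1)), Check n N m k := by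
  classical
  obtain ⟨m, hm1, hm2⟩ := exists_dig (N+2) (N+1) (fun a => min (t a) (N+1))
    (fun i => by have := Nat.min_le_right (t i) (N+1); omega)
  obtain ⟨k, hk1, hk2⟩ := exists_dig 2 ((n+1)*(N+1))
    (fun i => if sat t V (dec (i / (N+1))) (i % (N+1)) then 1 else 0)
    (fun i => by split_ifs <;> omega)
  refine ⟨m, hm1, k, hk1, ?_⟩
  have T1 : ∀ a, a ≤ N → t a ≤ N → tm N m a = t a := by
    intro a h1 h2
    unfold tm
    rw [hm2 a (by omega), if_pos (by omega)]
    omega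
  have T2 : ∀ a, N < t a → tm N m a = a + N + 1 := by
    intro a h2
    unfold tm
    by_cases h1 : a ≤ N
    · rw [hm2 a (by omega), if_neg (by omega)]
    · rw [if_neg (by omega)]
  have T3 : ∀ a, a ≤ N → tm N m a ≤ N → tm N m a = t a := by
    intro a h1 h2
    rcases Nat.lt_or_ge N (t a) with h | h
    · rw [T2 a h] at h2; omega
    · exact T1 a h1 h
  have S1 : ∀ e a, e ≤ n → a ≤ N → (Sm N k e a ↔ sat t V (dec e) a) := by
    intro e a he ha
    unfold Sm
    have hlt : e * (N+1) + a < (n+1)*(N+1) := by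
      have : (e+1)*(N+1) ≤ (n+1)*(N+1) := Nat.mul_le_mul_right _ (by omega)
      rw [Nat.add_mul e 1] at this
      omega
    rw [hk2 _ hlt]
    have d1 : (e * (N+1) + a) / (N+1) = e := by
      rw [Nat.add_comm, Nat.add_mul_div_right _ _ (by omega), Nat.div_eq_of_lt (by omega),
        Nat.zero_add]
    have d2 : (e * (N+1) + a) % (N+1) = a := by
      rw [Nat.add_comm, Nat.add_mul_mod_self_right, Nat.mod_eq_of_lt (by omega)]
    rw [d1, d2]
    simp
  refine ⟨?_, ?_, ?_, ?_, ?_⟩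
  · intro a ha
    rcases Nat.lt_or_ge N (t a) with h | h
    · rw [T2 a h]; omega
    · rw [T1 a (by omega) h]; exact ht.1 a
  · intro a ha
    have h2 := ht.2 a
    have h3 := ht.1 (a+1)
    rcases Nat.lt_or_ge N (t (a+1)) with h | h
    · rw [T2 (a+1) h]
      rcases Nat.lt_or_ge N (t a) with h' | h'
      · rw [T2 a h']; omega
      · rw [T1 a (by omega) h']; omega
    · rw [T1 (a+1) (by omega) h, T1 a (by omega) (by omega)]
      exact h2
  · have : ∀ i, i ≤ n + 1 → (tm N m)^[i] 0 = t^[i] 0 := by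
      intro i
      induction i with
      | zero => intro _; rfl
      | succ i ih =>
        intro hi
        rw [Function.iterate_succ_apply', ih (by omega), Function.iterate_succ_apply']
        have h1 : t^[i] 0 ≤ t^[n+1] 0 := (r_sm ht).monotone (by omega)
        have h2 : t^[i+1] 0 ≤ t^[n+1] 0 := (r_sm ht).monotone hi
        rw [Function.iterate_succ_apply'] at h2
        exact T1 _ (by omega) (by omega)
    rw [this _ le_rfl]
    exact hN
  · rw [S1 n 0 le_rfl (Nat.zero_le _)]; exact hs
  · intro e he a ha
    have u1 := Nat.unpair_right_le e
    have u2 := Nat.unpair_left_le (Nat.unpair e).2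
    have u3 := Nat.unpair_right_le (Nat.unpair e).2
    have hd : dec e = _ := dec.eq_1 e
    refine ⟨?_, ?_, ?_, ?_⟩
    · rw [S1 e a (by omega) (by omega), hd]
      by_cases h : (Nat.unpair e).1 = 1
      · right; simp [h, sat]
      · exact Or.inl h
    · rw [S1 e a (by omega) (by omega), S1 _ a (by omega) (by omega), S1 _ a (by omega) (by omega),
        hd]
      by_cases h : (Nat.unpair e).1 = 2
      · right; simp only [h]; simp only [sat, reduceDIte, reduceIte, OfNat.ofNat_ne_zero]
        tauto
      · exact Or.inl h
    · by_cases h : (Nat.unpair e).1 = 3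
      · right
        by_cases haN : a < N
        · right
          rw [S1 e a (by omega) (by omega), S1 _ (a+1) (by omega) (by omega), hd]
          simp [h, sat]
        · exact Or.inl haN
      · exact Or.inl h
    · by_cases h : (Nat.unpair e).1 = 4
      · right
        by_cases haN : tm N m a ≤ N
        · right
          have hTa := T3 a (by omega) haN
          rw [hTa] at haN ⊢
          rw [S1 e a (by omega) (by omega), hd]
          simp only [h]
          simp only [sat, reduceDIte, reduceIte, OfNat.ofNat_ne_zero, OfNat.ofNat_eq_ofNat,
            Nat.reduceEqDiff]
          constructor
          · rintro ⟨b, b1, b2, b3, b4⟩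
            refine ⟨b, by omega, b1, b2, (S1 _ b (by omega) (by omega)).2 b3, fun c hc => ?_⟩
            rcases Nat.lt_or_ge c a with h5 | h5
            · exact Or.inl h5
            · exact Or.inr ((S1 _ c (by omega) (by omega)).2 (b4 c h5 hc))
          · rintro ⟨b, b0, b1, b2, b3, b4⟩
            refine ⟨b, b1, b2, (S1 _ b (by omega) (by omega)).1 b3, fun c h5 hc => ?_⟩
            exact (S1 _ c (by omega) (by omega)).1 ((b4 c hc).resolve_left (by omega))
        · exact Or.inl haN
      · exact Or.inl h

lemma not_mem_iff_check (φ : Fml) : φ ∉ LTLNT ↔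
    ∃ m < (NB (encF φ)+2)^(NB (encF φ)+1), ∃ k < 2^((encF φ+1)*(NB (encF φ)+1)),
      Check (encF φ) (NB (encF φ)) m k := by
  constructor
  · intro h
    obtain ⟨t, V, h1, h2, h3⟩ := (not_mem_iff φ).1 h
    exact check_of_model t h1 V _ _ h3 (by rwa [dec_encF])
  · rintro ⟨m, _, k, _, h⟩ hmem
    have h1 := (check_sat h φ le_rfl 0 (Nat.zero_le _)).1 (hmem _ (tm_frame h) _ 0)
    exact h.2.2.2.1 h1

section PR
variable {α : Type} [Primcodable α]

lemma pr_ex {b : α → ℕ} {p : α → ℕ → Prop} (hb : Primrec b)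
    (hp : PrimrecPred fun x : α × ℕ => p x.1 x.2) : PrimrecPred fun a => ∃ x < b a, p a x := by
  have h : PrimrecRel (fun (x : ℕ) (a : α) => p a x) := hp.comp (Primrec.snd.pair Primrec.fst)
  exact (h.exists_mem_list.comp (Primrec.list_range.comp hb) Primrec.id).of_eq (by simp)

lemma pr_all {b : α → ℕ} {p : α → ℕ → Prop} (hb : Primrec b)
    (hp : PrimrecPred fun x : α × ℕ => p x.1 x.2) : PrimrecPred fun a => ∀ x < b a, p a x := by
  have h : PrimrecRel (fun (x : ℕ) (a : α) => p a x) := hp.comp (Primrec.snd.pair Primrec.fst)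
  exact (h.forall_mem_list.comp (Primrec.list_range.comp hb) Primrec.id).of_eq (by simp)

lemma pr_iff {p q : α → Prop} (hp : PrimrecPred p) (hq : PrimrecPred q) :
    PrimrecPred fun a => (p a ↔ q a) :=
  ((hp.and hq).or (hp.not.and hq.not)).of_eq fun a => by tauto

lemma pr_add {f g : α → ℕ} (hf : Primrec f) (hg : Primrec g) : Primrec fun a => f a + g a :=
  Primrec.nat_add.comp hf hg

lemma pr_mul {f g : α → ℕ} (hf : Primrec f) (hg : Primrec g) : Primrec fun a => f a * g a :=
  Primrec.nat_mul.comp hf hg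

lemma pr_lt {f g : α → ℕ} (hf : Primrec f) (hg : Primrec g) : PrimrecPred fun a => f a < g a :=
  Primrec.nat_lt.comp hf hg

lemma pr_le {f g : α → ℕ} (hf : Primrec f) (hg : Primrec g) : PrimrecPred fun a => f a ≤ g a :=
  Primrec.nat_le.comp hf hg

lemma pr_eq {f g : α → ℕ} (hf : Primrec f) (hg : Primrec g) : PrimrecPred fun a => f a = g a :=
  Primrec.eq.comp hf hg

lemma pr_u1 {f : α → ℕ} (hf : Primrec f) : Primrec fun a => (Nat.unpair (f a)).1 :=
  Primrec.fst.comp (Primrec.unpair.comp hf)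

lemma pr_u2 {f : α → ℕ} (hf : Primrec f) : Primrec fun a => (Nat.unpair (f a)).2 :=
  Primrec.snd.comp (Primrec.unpair.comp hf)

lemma pr_pow {f g : α → ℕ} (hf : Primrec f) (hg : Primrec g) : Primrec fun a => f a ^ g a := by
  have : Primrec fun a => (fun y => y * f a)^[g a] 1 :=
    Primrec.nat_iterate hg (Primrec.const 1)
      (Primrec.nat_mul.comp Primrec.snd (hf.comp Primrec.fst))
  refine this.of_eq fun a => ?_
  induction g a with
  | zero => simp
  | succ n ih => rw [Function.iterate_succ_apply', ih, pow_succ]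

lemma pr_dig {K m i : α → ℕ} (hK : Primrec K) (hm : Primrec m) (hi : Primrec i) :
    Primrec fun a => dig (K a) (m a) (i a) :=
  Primrec.nat_mod.comp (Primrec.nat_div.comp hm (pr_pow hK hi)) hK

lemma pr_tm {N m a : α → ℕ} (hN : Primrec N) (hm : Primrec m) (ha : Primrec a) :
    Primrec fun x => tm (N x) (m x) (a x) := by
  have hd := pr_dig (pr_add hN (Primrec.const 2)) hm ha
  exact Primrec.ite ((pr_le ha hN).and (pr_le hd hN)) hd
    (pr_add (pr_add ha hN) (Primrec.const 1))

lemma pr_Sm {N m e a : α → ℕ} (hN : Primrec N) (hm : Primrec m) (he : Primrec e)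
    (ha : Primrec a) : PrimrecPred fun x => Sm (N x) (m x) (e x) (a x) :=
  pr_eq (pr_dig (Primrec.const 2) hm
    (pr_add (pr_mul he (pr_add hN (Primrec.const 1))) ha)) (Primrec.const 1)

lemma pr_Loc {N m k e a : α → ℕ} (hN : Primrec N) (hm : Primrec m) (hk : Primrec k)
    (he : Primrec e) (ha : Primrec a) :
    PrimrecPred fun x => Loc (N x) (m x) (k x) (e x) (a x) := by
  have tag := fun i : ℕ => (pr_eq (pr_u1 he) (Primrec.const i)).not
  have S := pr_Sm hN hk he ha
  have e1 := pr_u1 (pr_u2 he)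
  have e2 := pr_u2 (pr_u2 he)
  have f1 : Primrec (Prod.fst : α × ℕ → α) := Primrec.fst
  have f2 : Primrec (Prod.snd : α × ℕ → ℕ) := Primrec.snd
  have g1 : Primrec (fun x : (α × ℕ) × ℕ => x.1.1) := Primrec.fst.comp Primrec.fst
  have g2 : Primrec (fun x : (α × ℕ) × ℕ => x.2) := Primrec.snd
  refine ((tag 1).or S.not).and (((tag 2).or (pr_iff S ?_)).and
    (((tag 3).or ((pr_lt ha hN).not.or (pr_iff S ?_))).and
    ((tag 4).or ((pr_le (pr_tm hN hm ha) hN).not.or (pr_iff S ?_)))))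
  · exact (pr_Sm hN hk e1 ha).not.or (pr_Sm hN hk e2 ha)
  · exact pr_Sm hN hk (pr_u2 he) (pr_add ha (Primrec.const 1))
  · refine pr_ex (pr_add hN (Primrec.const 1)) ?_
    refine (pr_le (ha.comp f1) f2).and ((pr_le f2 ((pr_tm hN hm ha).comp f1)).and
      ((pr_Sm (hN.comp f1) (hk.comp f1) (e2.comp f1) f2).and (pr_all f2 ?_)))
    exact (pr_lt g2 (ha.comp g1)).or (pr_Sm (hN.comp g1) (hk.comp g1) (e1.comp g1) g2)

lemma pr_Check {n N m k : α → ℕ} (hn : Primrec n) (hN : Primrec N) (hm : Primrec m)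
    (hk : Primrec k) : PrimrecPred fun x => Check (n x) (N x) (m x) (k x) := by
  have f1 : Primrec (Prod.fst : α × ℕ → α) := Primrec.fst
  have f2 : Primrec (Prod.snd : α × ℕ → ℕ) := Primrec.snd
  have g1 : Primrec (fun x : (α × ℕ) × ℕ => x.1.1) := Primrec.fst.comp Primrec.fst
  have g2 : Primrec (fun x : (α × ℕ) × ℕ => x.2) := Primrec.snd
  have g3 : Primrec (fun x : (α × ℕ) × ℕ => x.1.2) := Primrec.snd.comp Primrec.fst
  have hN1 := pr_add hN (Primrec.const 1)
  have hn1 := pr_add hn (Primrec.const 1)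
  have t0 := pr_tm (hN.comp f1) (hm.comp f1) f2
  have t1 := pr_tm (hN.comp f1) (hm.comp f1) (pr_add f2 (Primrec.const 1))
  refine (pr_all hN1 (pr_lt f2 t0)).and ((pr_all hN1 (pr_lt t0 t1)).and
    ((pr_le ?_ hN).and ((pr_Sm hN hk hn (Primrec.const 0)).not.and
      (pr_all hn1 (pr_all (hN1.comp f1) ?_)))))
  · exact Primrec.nat_iterate hn1 (Primrec.const 0) t0
  · exact pr_Loc (hN.comp g1) (hm.comp g1) (hk.comp g1) g3 g2

end PR

lemma pr_NB : Primrec NB := by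
  have h1 := pr_add (Primrec.id (α := ℕ)) (Primrec.const 1)
  exact pr_mul h1 (pr_pow (Primrec.const 2)
    (pr_mul h1 (pr_mul h1 (pr_mul h1 (Primrec.const 5)))))

lemma pr_final : PrimrecPred fun n : ℕ =>
    ∃ m < (NB n+2)^(NB n+1), ∃ k < 2^((n+1)*(NB n+1)), Check n (NB n) m k := by
  have f1 : Primrec (Prod.fst : ℕ × ℕ → ℕ) := Primrec.fst
  have g1 : Primrec (fun x : (ℕ × ℕ) × ℕ => x.1.1) := Primrec.fst.comp Primrec.fst
  have g2 : Primrec (fun x : (ℕ × ℕ) × ℕ => x.2) := Primrec.snd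
  have g3 : Primrec (fun x : (ℕ × ℕ) × ℕ => x.1.2) := Primrec.snd.comp Primrec.fst
  have hN1 := pr_add pr_NB (Primrec.const 1)
  refine pr_ex (pr_pow (pr_add pr_NB (Primrec.const 2)) hN1) (pr_ex ?_ ?_)
  · exact (pr_pow (Primrec.const 2)
      (pr_mul (pr_add (Primrec.id (α := ℕ)) (Primrec.const 1)) hN1)).comp f1
  · exact pr_Check g1 (pr_NB.comp g1) g3 g2

end NTDec

/-- LTL_NT is decidable. -/
theorem stmt4 :
    ∃ f : ℕ → Bool, Computable f ∧
      ∀ φ : Fml, (f (encF φ) = true ↔ φ ∈ LTLNT) := by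

  classical
  refine ⟨fun n => decide (¬ ∃ m < (NTDec.NB n+2)^(NTDec.NB n+1),
    ∃ k < 2^((n+1)*(NTDec.NB n+1)), NTDec.Check n (NTDec.NB n) m k), ?_, fun φ => ?_⟩
  · exact (NTDec.pr_final.not.decide).to_comp
  · rw [decide_eq_true_iff, ← NTDec.not_mem_iff_check, not_not]
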